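/- arXiv:2104.11945 — 2 statements merged into one kernel-verified Lean document; each statement's English description precedes it below -/
import Mathlib

section
/- The following elements form a basis of R^{Σ_n} as a k-module: the products (∏_{i=1}^n e_i^{r_i})·(∏_{s=0}^{n}∏_{i=1}^{n−s} c_{s,i}^{ε_{s,i}}), where the r_i range over all nonnegative integers and the exponents ε_{s,i} ∈ {0,1} (for 0 ≤ s ≤ n, 1 ≤ i ≤ n − s) are subject to the condition: whenever ε_{s,i} = 1 and ε_{t,j} = 1 for two distinct pairs (s,i) ≠ (t,j) with s ≤ t, then s + i < t. -/
open MvPolynomial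

set_option synthInstance.maxHeartbeats 1000000
set_option maxHeartbeats 1000000

noncomputable section

variable (k : Type) [CommRing k] (n : ℕ)

/-- The set of relations `u_i ^ 2 - u_i`, where `u_i = X (Sum.inr i)` and `w_i = X (Sum.inl i)`. -/
def relSet : Set (MvPolynomial (Fin n ⊕ Fin n) k) :=
  Set.range fun i : Fin n => X (Sum.inr i) ^ 2 - X (Sum.inr i)

/-- The ring `R = k[w_1,…,w_n,u_1,…,u_n]/(u_i² − u_i)`. -/
abbrev RR := MvPolynomial (Fin n ⊕ Fin n) k ⧸ Ideal.span (relSet k n)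

/-- The action of a permutation `σ ∈ Σ_n` on `R`, permuting the `w_i` and `u_i` separately. -/
def permAut (σ : Equiv.Perm (Fin n)) : RR k n →ₐ[k] RR k n :=
  Ideal.Quotient.liftₐ (Ideal.span (relSet k n))
    ((Ideal.Quotient.mkₐ k (Ideal.span (relSet k n))).comp (rename (Sum.map σ σ)))
    (by
      intro a ha
      have hmem : rename (Sum.map σ σ) a ∈ Ideal.span (relSet k n) := by
        have hmap : Ideal.map ((rename (Sum.map ⇑σ ⇑σ) : MvPolynomial (Fin n ⊕ Fin n) k →ₐ[k] MvPolynomial (Fin n ⊕ Fin n) k) : MvPolynomial (Fin n ⊕ Fin n) k →+* MvPolynomial (Fin n ⊕ Fin n) k)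
            (Ideal.span (relSet k n)) ≤ Ideal.span (relSet k n) := by
          rw [Ideal.map_span, Ideal.span_le]
          rintro x ⟨p, ⟨i, rfl⟩, rfl⟩
          refine Ideal.subset_span ?_
          refine ⟨σ i, ?_⟩
          simp [map_sub, map_pow, rename_X]
        exact hmap (Ideal.mem_map_of_mem _ ha)
      simp only [AlgHom.comp_apply, Ideal.Quotient.mkₐ_eq_mk]
      rw [Ideal.Quotient.eq_zero_iff_mem]
      exact hmem)

/-- The invariant subalgebra `R^{Σ_n}`. -/
def invariants : Subalgebra k (RR k n) where
  carrier := {x | ∀ σ : Equiv.Perm (Fin n), permAut k n σ x = x}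
  mul_mem' := fun hx hy σ => by rw [map_mul, hx σ, hy σ]
  one_mem' := fun σ => map_one _
  add_mem' := fun hx hy σ => by rw [map_add, hx σ, hy σ]
  zero_mem' := fun σ => map_zero _
  algebraMap_mem' := fun r σ => AlgHom.commutes _ r

/-- The polynomial `C_{s,i}`: the sum over all pairs of disjoint subsets
`{m_1<⋯<m_s}`, `{l_1<⋯<l_i}` of `{1,…,n}` of `w_{m_1}⋯w_{m_s}·u_{l_1}⋯u_{l_i}`. -/
def Cpoly (s i : ℕ) : MvPolynomial (Fin n ⊕ Fin n) k :=
  ∑ p ∈ Finset.univ.filter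
      (fun p : Finset (Fin n) × Finset (Fin n) =>
        p.1.card = s ∧ p.2.card = i ∧ Disjoint p.1 p.2),
    (∏ m ∈ p.1, X (Sum.inl m)) * ∏ l ∈ p.2, X (Sum.inr l)

/-- The element `c_{s,i} ∈ R`. -/
def cElt (s i : ℕ) : RR k n := Ideal.Quotient.mk _ (Cpoly k n s i)

/-- `e_i = c_{i,0}`, the `i`-th elementary symmetric polynomial in `w_1,…,w_n`
(here `i : Fin n` encodes the index `i+1 ∈ {1,…,n}`). -/
def eElt (i : Fin n) : RR k n := cElt k n (i + 1) 0

/-- Admissibility condition on the exponents `ε_{s,i} ∈ {0,1}`: they are supported on pairs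
`(s,i)` with `0 ≤ s ≤ n`, `1 ≤ i ≤ n − s`, and whenever `ε_{s,i} = ε_{t,j} = 1` for distinct
pairs `(s,i) ≠ (t,j)` with `s ≤ t`, then `s + i < t`. -/
def Admissible (ε : ℕ → ℕ → Bool) : Prop :=
  (∀ s i, ε s i = true → s ≤ n ∧ 1 ≤ i ∧ i ≤ n - s) ∧
  (∀ s i t j, ε s i = true → ε t j = true → (s, i) ≠ (t, j) → s ≤ t → s + i < t)

/-- The product `(∏_{i=1}^n e_i^{r_i})·(∏_{s=0}^{n}∏_{i=1}^{n−s} c_{s,i}^{ε_{s,i}})`. -/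
def basisElt (r : Fin n → ℕ) (ε : ℕ → ℕ → Bool) : RR k n :=
  (∏ i : Fin n, eElt k n i ^ r i) *
    ∏ s ∈ Finset.range (n + 1), ∏ i ∈ Finset.range (n + 1),
      if ε s i then cElt k n s i else 1

section Aux1

open scoped MonomialOrder

/-- The lex order with `w_1 > ... > w_n > u_1 > ... > u_n`. -/
def mord (n : ℕ) : MonomialOrder (Fin n ⊕ Fin n) where
  syn := Lex ((Lex (Fin n ⊕ Fin n)) →₀ ℕ)
  toSyn := (Finsupp.domCongr (M := ℕ) (toLex (α := Fin n ⊕ Fin n))).trans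
    { toEquiv := toLex, map_add' := toLex_add }
  toSyn_monotone := by
    intro a b h
    refine Finsupp.toLex_monotone ?_
    intro i
    exact h _

lemma mord_lt {n : ℕ} (a b : (Fin n ⊕ Fin n) →₀ ℕ) :
    (mord n).toSyn a < (mord n).toSyn b ↔
    (∃ p, (∀ q < p, a (Sum.inl q) = b (Sum.inl q)) ∧ a (Sum.inl p) < b (Sum.inl p)) ∨
    (∃ p, (∀ q, a (Sum.inl q) = b (Sum.inl q)) ∧ (∀ q < p, a (Sum.inr q) = b (Sum.inr q)) ∧
      a (Sum.inr p) < b (Sum.inr p)) := by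
  have h : (mord n).toSyn a < (mord n).toSyn b ↔ ∃ j : Fin n ⊕ Fin n,
      (∀ d : Fin n ⊕ Fin n, toLex d < toLex j → a d = b d) ∧ a j < b j := by
    constructor
    · intro h
      obtain ⟨j, h1, h2⟩ := Finsupp.Lex.lt_iff.1 h
      exact ⟨ofLex j, fun d hd => h1 (toLex d) hd, h2⟩
    · rintro ⟨j, h1, h2⟩
      exact Finsupp.Lex.lt_iff.2 ⟨toLex j, fun d hd => h1 (ofLex d) hd, h2⟩
  rw [h]
  constructor
  · rintro ⟨j | j, h1, h2⟩
    · exact Or.inl ⟨j, fun q hq => h1 _ (by simpa using hq), h2⟩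
    · exact Or.inr ⟨j, fun q => h1 _ (by simp), fun q hq => h1 _ (by simpa using hq), h2⟩
  · rintro (⟨j, h1, h2⟩ | ⟨j, h1, h2, h3⟩)
    · refine ⟨Sum.inl j, ?_, h2⟩
      rintro (d | d) hd
      · exact h1 _ (by simpa using hd)
      · simp at hd
    · refine ⟨Sum.inr j, ?_, h3⟩
      rintro (d | d) hd
      · exact h1 _
      · exact h2 _ (by simpa using hd)

/-- `E` is the leading exponent of `p`, with coefficient `1`. -/
def IsLead {k : Type} [CommRing k] {σ : Type} (m : MonomialOrder σ) (p : MvPolynomial σ k) (E : σ →₀ ℕ) : Prop :=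
  coeff E p = 1 ∧ ∀ e, coeff e p ≠ 0 → m.toSyn e ≤ m.toSyn E

lemma IsLead.one {k : Type} [CommRing k] {σ : Type} (m : MonomialOrder σ) :
    IsLead m (1 : MvPolynomial σ k) 0 := by
  classical
  refine ⟨by simp, fun e he => ?_⟩
  rw [MvPolynomial.coeff_one] at he
  by_cases h : 0 = e
  · rw [h]
  · simp [h] at he

lemma IsLead.mul {k : Type} [CommRing k] {σ : Type} {m : MonomialOrder σ} {p q : MvPolynomial σ k}
    {E F : σ →₀ ℕ} (hp : IsLead m p E) (hq : IsLead m q F) : IsLead m (p * q) (E + F) := by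
  have dp : m.degree p ≼[m] E := m.degree_le_iff.2 fun c hc => hp.2 c (by simpa using hc)
  have dq : m.degree q ≼[m] F := m.degree_le_iff.2 fun c hc => hq.2 c (by simpa using hc)
  refine ⟨?_, fun e he => ?_⟩
  · rw [m.coeff_mul_of_add_of_degree_le dp dq, hp.1, hq.1, one_mul]
  · have h1 := m.le_degree (f := p * q) (d := e) (by simpa using he)
    refine h1.trans (m.degree_mul_le.trans ?_)
    rw [map_add, map_add]
    exact add_le_add dp dq

lemma IsLead.pow {k : Type} [CommRing k] {σ : Type} {m : MonomialOrder σ} {p : MvPolynomial σ k}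
    {E : σ →₀ ℕ} (hp : IsLead m p E) (r : ℕ) : IsLead m (p ^ r) (r • E) := by
  induction r with
  | zero => simpa using IsLead.one m
  | succ r ih => rw [pow_succ, succ_nsmul]; exact ih.mul hp

lemma IsLead.prod {k : Type} [CommRing k] {σ : Type} {m : MonomialOrder σ} {ι : Type}
    (s : Finset ι) (p : ι → MvPolynomial σ k)
    (E : ι → σ →₀ ℕ) (hp : ∀ i ∈ s, IsLead m (p i) (E i)) :
    IsLead m (∏ i ∈ s, p i) (∑ i ∈ s, E i) := by
  classical
  induction s using Finset.induction_on with
  | empty => simpa using IsLead.one m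
  | insert a s ha ih =>
    rw [Finset.prod_insert ha, Finset.sum_insert ha]
    exact (hp a (by simp)).mul (ih fun i hi => hp i (by simp [hi]))

lemma abs_basis {k : Type} [CommRing k] {σ Q V : Type} [AddCommGroup V] [Module k V]
    (m : MonomialOrder σ) (f : V →ₗ[k] MvPolynomial σ k) (hf : Function.Injective f)
    (v : Q → V) (l : Q → σ →₀ ℕ) (hl : Function.Injective l)
    (h1 : ∀ q, IsLead m (f (v q)) (l q))
    (h3 : ∀ x, x ≠ 0 → ∃ q, m.degree (f x) = l q) :
    LinearIndependent k v ∧ ⊤ ≤ Submodule.span k (Set.range v) := by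
  classical
  constructor
  · rw [linearIndependent_iff']
    intro s g hg
    by_contra! hne
    obtain ⟨i, hi, hgi⟩ := hne
    obtain ⟨q, hq, hmax⟩ := Finset.exists_max_image (s.filter fun i => g i ≠ 0)
      (fun i => m.toSyn (l i)) ⟨i, by simp [hi, hgi]⟩
    rw [Finset.mem_filter] at hq
    have h := congrArg (fun x => coeff (l q) (f x)) hg
    simp only [map_sum, map_smul, MvPolynomial.coeff_sum, MvPolynomial.coeff_smul, map_zero, smul_eq_mul,
      MvPolynomial.coeff_zero] at h
    rw [Finset.sum_eq_single q] at h
    · rw [(h1 q).1, mul_one] at h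
      exact hq.2 h
    · intro j hj hjq
      by_cases hgj : g j = 0
      · simp [hgj]
      · by_cases hc : coeff (l q) (f (v j)) = 0
        · simp [hc]
        · exfalso
          have a1 := (h1 j).2 _ hc
          have a2 := hmax j (by simp [hj, hgj])
          exact hjq (hl (m.toSyn.injective (le_antisymm a2 a1)))
    · intro h; exact absurd hq.1 h
  · intro x _
    induction hd : m.toSyn (m.degree (f x)) using WellFoundedLT.induction generalizing x with
    | ind d ih =>
    by_cases hx : x = 0
    · rw [hx]; exact zero_mem _
    obtain ⟨q, hq⟩ := h3 x hx
    set c := coeff (l q) (f x) with hc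
    have key : x - c • v q ∈ Submodule.span k (Set.range v) := by
      by_cases hy : x - c • v q = 0
      · rw [hy]; exact zero_mem _
      refine ih (m.toSyn (m.degree (f (x - c • v q)))) ?_ Submodule.mem_top rfl
      have hfy : f (x - c • v q) ≠ 0 := fun h => hy (hf (by simpa using h))
      have hcoef := m.degree_mem_support hfy
      rw [MvPolynomial.mem_support_iff] at hcoef
      rw [← hd, hq]
      refine lt_of_le_of_ne ?_ ?_
      · by_contra hlt
        apply hcoef
        have z1 : coeff (m.degree (f (x - c • v q))) (f x) = 0 := by
          by_contra hz
          exact hlt (hq ▸ m.le_degree (by simpa using hz))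
        have z2 : coeff (m.degree (f (x - c • v q))) (f (v q)) = 0 := by
          by_contra hz
          exact hlt ((h1 q).2 _ hz)
        rw [map_sub, map_smul] at z1 z2 ⊢
        rw [MvPolynomial.coeff_sub, MvPolynomial.coeff_smul, z1, z2]; simp
      · intro he
        have he := m.toSyn.injective he
        apply hcoef
        rw [he, map_sub, map_smul, MvPolynomial.coeff_sub, MvPolynomial.coeff_smul, (h1 q).1, ← hc]
        simp
    have := add_mem key (Submodule.smul_mem _ c (Submodule.subset_span (Set.mem_range_self q)))
    simpa using this

end Aux1

section Aux2

/-- exponent vector from its `w` and `u` parts -/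
def ex {n : ℕ} (a b : Fin n → ℕ) : (Fin n ⊕ Fin n) →₀ ℕ := Finsupp.equivFunOnFinite.symm (Sum.elim a b)

@[simp] lemma ex_inl {n : ℕ} (a b : Fin n → ℕ) (i) : ex a b (Sum.inl i) = a i := rfl
@[simp] lemma ex_inr {n : ℕ} (a b : Fin n → ℕ) (i) : ex a b (Sum.inr i) = b i := rfl

lemma ex_eta {n : ℕ} (e : (Fin n ⊕ Fin n) →₀ ℕ) :
    e = ex (fun i => e (Sum.inl i)) (fun i => e (Sum.inr i)) := by
  ext (i | i) <;> rfl

/-- reduction of exponents mod `u^2 = u` -/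
def red {n : ℕ} (e : (Fin n ⊕ Fin n) →₀ ℕ) : (Fin n ⊕ Fin n) →₀ ℕ :=
  ex (fun i => e (Sum.inl i)) (fun i => min (e (Sum.inr i)) 1)

@[simp] lemma red_inl {n : ℕ} (e : (Fin n ⊕ Fin n) →₀ ℕ) (i) : red e (Sum.inl i) = e (Sum.inl i) := rfl
@[simp] lemma red_inr {n : ℕ} (e : (Fin n ⊕ Fin n) →₀ ℕ) (i) : red e (Sum.inr i) = min (e (Sum.inr i)) 1 := rfl

lemma red_le {n : ℕ} (e : (Fin n ⊕ Fin n) →₀ ℕ) : red e ≤ e := by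
  rintro (i | i) <;> simp

lemma red_red {n : ℕ} (e : (Fin n ⊕ Fin n) →₀ ℕ) : red (red e) = red e := by
  ext (i | i) <;> simp


/-- normal form of polynomials -/
def NF : MvPolynomial (Fin n ⊕ Fin n) k →ₗ[k] MvPolynomial (Fin n ⊕ Fin n) k :=
  (basisMonomials (Fin n ⊕ Fin n) k).constr k (fun e => monomial (red e) (1 : k))

lemma NF_monomial (e) (c : k) : NF k n (monomial e c) = monomial (red e) c := by
  have h : NF k n (monomial e 1) = monomial (red e) 1 := by
    have := (basisMonomials (Fin n ⊕ Fin n) k).constr_basis k (fun e => monomial (red e) (1 : k)) e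
    rwa [coe_basisMonomials] at this
  have h2 : (monomial e c : MvPolynomial (Fin n ⊕ Fin n) k) = c • monomial e 1 := by
    rw [smul_monomial]; simp
  rw [h2, map_smul, h, smul_monomial]; simp

lemma NF_coeff (p : MvPolynomial (Fin n ⊕ Fin n) k) (x) :
    coeff x (NF k n p) = ∑ e ∈ p.support, if red e = x then coeff e p else 0 := by
  classical
  conv_lhs => rw [p.as_sum]
  rw [map_sum, MvPolynomial.coeff_sum]
  refine Finset.sum_congr rfl fun e _ => ?_
  rw [NF_monomial, coeff_monomial]

lemma NF_red (p : MvPolynomial (Fin n ⊕ Fin n) k) (x) (h : coeff x (NF k n p) ≠ 0) : red x = x := by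
  rw [NF_coeff] at h
  obtain ⟨e, _, he⟩ := Finset.exists_ne_zero_of_sum_ne_zero h
  by_cases hr : red e = x
  · rw [← hr, red_red]
  · simp [hr] at he

lemma NF_lead (p : MvPolynomial (Fin n ⊕ Fin n) k) (E) (hp : IsLead (mord n) p E) (hE : red E = E) :
    IsLead (mord n) (NF k n p) E := by
  constructor
  · rw [NF_coeff, Finset.sum_eq_single E]
    · rw [if_pos hE, hp.1]
    · intro e he hne
      rw [if_neg]
      intro hr
      have h1 := hp.2 e (by simpa using he)
      have h2 : (mord n).toSyn E ≤ (mord n).toSyn e := by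
        rw [← hr]; exact (mord n).toSyn_monotone (red_le e)
      exact hne ((mord n).toSyn.injective (le_antisymm h1 h2))
    · intro h
      rw [MvPolynomial.notMem_support_iff] at h
      simp [h]
  · intro x hx
    rw [NF_coeff] at hx
    obtain ⟨e, he0, he⟩ := Finset.exists_ne_zero_of_sum_ne_zero hx
    by_cases hr : red e = x
    · rw [← hr]
      exact ((mord n).toSyn_monotone (red_le e)).trans (hp.2 e (by simpa using he0))
    · simp [hr] at he

lemma NF_ideal (x) (hx : x ∈ Ideal.span (relSet k n)) : NF k n x = 0 := by
  suffices h : ∀ q, NF k n (q * x) = 0 by simpa using h 1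
  induction hx using Submodule.span_induction with
  | mem x hx =>
    obtain ⟨i, rfl⟩ := hx
    intro q
    induction q using MvPolynomial.induction_on' with
    | monomial e c =>
      have h2 : (X (Sum.inr i) ^ 2 : MvPolynomial (Fin n ⊕ Fin n) k) = monomial (Finsupp.single (Sum.inr i) 2) 1 :=
        MvPolynomial.X_pow_eq_monomial
      have h1 : (X (Sum.inr i) : MvPolynomial (Fin n ⊕ Fin n) k) = monomial (Finsupp.single (Sum.inr i) 1) 1 := rfl
      dsimp only
      rw [h2, h1, mul_sub, monomial_mul, monomial_mul, map_sub, NF_monomial, NF_monomial, sub_eq_zero]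
      refine congrArg (fun e => monomial e (c * 1)) ?_
      ext (j | j)
      · simp
      · by_cases hj : i = j
        · subst hj; simp
        · have : (Sum.inr j : Fin n ⊕ Fin n) ≠ Sum.inr i := by simpa using Ne.symm hj
          simp [hj]
    | add p q hp hq => rw [add_mul, map_add, hp, hq, add_zero]
  | zero => simp
  | add x y _ _ hx hy => intro q; rw [mul_add, map_add, hx, hy, add_zero]
  | smul a x _ hx => intro q; rw [smul_eq_mul, ← mul_assoc]; exact hx _

lemma u_idem (i : Fin n) (r : ℕ) :
    (Ideal.Quotient.mk (Ideal.span (relSet k n)) (X (Sum.inr i))) ^ r =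
    (Ideal.Quotient.mk (Ideal.span (relSet k n)) (X (Sum.inr i))) ^ (min r 1) := by
  have h : IsIdempotentElem (Ideal.Quotient.mk (Ideal.span (relSet k n)) (X (Sum.inr i))) := by
    unfold IsIdempotentElem
    rw [← map_mul, Ideal.Quotient.eq, ← sq]
    exact Ideal.subset_span ⟨i, rfl⟩
  rcases r with _ | r
  · rfl
  · rw [h.pow_succ_eq]; simp

lemma mk_NF (p : MvPolynomial (Fin n ⊕ Fin n) k) :
    Ideal.Quotient.mk (Ideal.span (relSet k n)) (NF k n p) = Ideal.Quotient.mk (Ideal.span (relSet k n)) p := by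
  induction p using MvPolynomial.induction_on' with
  | monomial e c =>
    rw [NF_monomial, monomial_eq, monomial_eq, Finsupp.prod_fintype _ _ (by simp),
      Finsupp.prod_fintype _ _ (by simp), Fintype.prod_sum_type, Fintype.prod_sum_type]
    simp only [map_mul, map_prod, map_pow, red_inl, red_inr]
    congr 2
    exact Finset.prod_congr rfl fun i _ => (u_idem k n i _).symm
  | add p q hp hq => rw [map_add, map_add, map_add, hp, hq]

/-- normal form on `R` -/
def nf : RR k n →ₗ[k] MvPolynomial (Fin n ⊕ Fin n) k where
  toFun x := NF k n (Function.surjInv Ideal.Quotient.mk_surjective x)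
  map_add' x y := by
    rw [← map_add, ← sub_eq_zero, ← map_sub]
    apply NF_ideal
    rw [← Ideal.Quotient.eq, map_add]
    simp only [Function.surjInv_eq]
  map_smul' c x := by
    rw [RingHom.id_apply, ← map_smul, ← sub_eq_zero, ← map_sub]
    apply NF_ideal
    rw [← Ideal.Quotient.eq]
    refine (Function.surjInv_eq _ _).trans ?_
    exact congrArg (c • ·) (Function.surjInv_eq Ideal.Quotient.mk_surjective x).symm

lemma nf_mk (p) : nf k n (Ideal.Quotient.mk _ p) = NF k n p := by
  change NF k n _ = _
  rw [← sub_eq_zero, ← map_sub]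
  apply NF_ideal
  rw [← Ideal.Quotient.eq]
  simp only [Function.surjInv_eq]

lemma nf_inj : Function.Injective (nf k n) := by
  intro x y h
  obtain ⟨p, rfl⟩ := Ideal.Quotient.mk_surjective x
  obtain ⟨q, rfl⟩ := Ideal.Quotient.mk_surjective y
  rw [nf_mk, nf_mk] at h
  rw [← mk_NF, h, mk_NF]

lemma mapDomain_sum (σ : Equiv.Perm (Fin n)) (e : (Fin n ⊕ Fin n) →₀ ℕ) :
    Finsupp.mapDomain (Sum.map σ σ) e = ex (fun i => e (Sum.inl (σ.symm i))) (fun i => e (Sum.inr (σ.symm i))) := by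
  have h : Finsupp.mapDomain (Sum.map σ σ) e = Finsupp.mapDomain (Equiv.sumCongr σ σ) e := rfl
  rw [h]
  ext (i | i)
  · rw [Finsupp.mapDomain_equiv_apply]; rfl
  · rw [Finsupp.mapDomain_equiv_apply]; rfl

lemma NF_rename (σ : Equiv.Perm (Fin n)) (p) :
    NF k n (rename (Sum.map σ σ) p) = rename (Sum.map σ σ) (NF k n p) := by
  induction p using MvPolynomial.induction_on' with
  | monomial e c =>
    rw [rename_monomial, NF_monomial, NF_monomial, rename_monomial, mapDomain_sum, mapDomain_sum]
    rfl
  | add p q hp hq => simp only [map_add, hp, hq]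

lemma permAut_mk (σ : Equiv.Perm (Fin n)) (p) :
    permAut k n σ (Ideal.Quotient.mk _ p) = Ideal.Quotient.mk _ (rename (Sum.map σ σ) p) := by
  rfl

lemma nf_perm (σ : Equiv.Perm (Fin n)) (x) :
    nf k n (permAut k n σ x) = rename (Sum.map σ σ) (nf k n x) := by
  obtain ⟨p, rfl⟩ := Ideal.Quotient.mk_surjective x
  rw [permAut_mk, nf_mk, nf_mk, NF_rename]

/-- Leading exponents of symmetric elements. -/
lemma lead_canonical (x : RR k n) (hx : x ∈ invariants k n) (hx0 : x ≠ 0) (E)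
    (hE : E = (mord n).degree (nf k n x)) :
    (∀ i, E (Sum.inr i) ≤ 1) ∧
    ∀ i j : Fin n, i.val + 1 = j.val → (E (Sum.inl j) < E (Sum.inl i) ∨
      (E (Sum.inl j) = E (Sum.inl i) ∧ E (Sum.inr j) ≤ E (Sum.inr i))) := by
  have h0 : nf k n x ≠ 0 := fun h => hx0 (nf_inj k n (by simpa using h))
  have hc : coeff E (nf k n x) ≠ 0 := by
    rw [hE]; simpa using (mord n).degree_mem_support h0
  constructor
  · obtain ⟨p, rfl⟩ := Ideal.Quotient.mk_surjective x
    rw [nf_mk] at hc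
    have := NF_red k n p E hc
    intro i
    have h := DFunLike.congr_fun this (Sum.inr i)
    rw [red_inr] at h
    omega
  · intro i j hij
    have hs : (mord n).toSyn (Finsupp.mapDomain (Sum.map (Equiv.swap i j) (Equiv.swap i j)) E) ≤ (mord n).toSyn E := by
      rw [hE]
      apply (mord n).le_degree
      rw [← hE, MvPolynomial.mem_support_iff]
      have := hx (Equiv.swap i j)
      rw [← this, nf_perm, coeff_rename_mapDomain]
      · exact hc
      · exact (Equiv.sumCongr (Equiv.swap i j) (Equiv.swap i j)).injective
    by_contra hcon
    push Not at hcon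
    obtain ⟨h1, h2⟩ := hcon
    apply hs.not_gt
    rw [mapDomain_sum, mord_lt]
    have lt_ne : ∀ q, q < i → Equiv.swap i j q = q := fun q hq =>
      Equiv.swap_apply_of_ne_of_ne (by rintro rfl; exact lt_irrefl _ hq)
        (by rintro rfl; rw [Fin.lt_def] at hq; omega)
    rcases h1.lt_or_eq with h1 | h1
    · left
      refine ⟨i, fun q hq => ?_, ?_⟩
      · simp [lt_ne q hq]
      · simpa using h1
    · right
      refine ⟨i, fun q => ?_, fun q hq => ?_, ?_⟩
      · simp only [ex_inl, Equiv.symm_swap]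
        by_cases hqi : q = i
        · subst hqi; simp [h1]
        by_cases hqj : q = j
        · subst hqj; simp [h1]
        rw [Equiv.swap_apply_of_ne_of_ne hqi hqj]
      · simp [lt_ne q hq]
      · simpa using h2 h1.symm

end Aux2

section Aux3

/-- indicator function of a finset -/
def ind {n : ℕ} (M : Finset (Fin n)) (j : Fin n) : ℕ := if j ∈ M then 1 else 0

lemma ind_inj {n : ℕ} {M N : Finset (Fin n)} (h : ∀ j, ind M j = ind N j) : M = N := by
  ext j
  have := h j
  unfold ind at this
  by_cases h1 : j ∈ M <;> by_cases h2 : j ∈ N <;> simp_all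

lemma prod_monomial (M L : Finset (Fin n)) :
    ((∏ m ∈ M, X (Sum.inl m)) * ∏ l ∈ L, X (Sum.inr l) : MvPolynomial (Fin n ⊕ Fin n) k) =
    monomial (ex (ind M) (ind L)) 1 := by
  rw [monomial_eq, Finsupp.prod_fintype _ _ (by simp), Fintype.prod_sum_type]
  simp [ind, pow_ite]

lemma Cpoly_eq (s i : ℕ) : Cpoly k n s i = ∑ p ∈ Finset.univ.filter
      (fun p : Finset (Fin n) × Finset (Fin n) =>
        p.1.card = s ∧ p.2.card = i ∧ Disjoint p.1 p.2), monomial (ex (ind p.1) (ind p.2)) 1 :=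
  Finset.sum_congr rfl fun p _ => prod_monomial k n p.1 p.2

lemma Cpoly_perm (s i : ℕ) (σ : Equiv.Perm (Fin n)) :
    rename (Sum.map σ σ) (Cpoly k n s i) = Cpoly k n s i := by
  unfold Cpoly
  rw [map_sum]
  refine Finset.sum_equiv (Equiv.prodCongr σ.finsetCongr σ.finsetCongr) ?_ ?_
  · intro p
    simp
  · intro p _
    simp [map_mul, map_prod, Finset.prod_map]

lemma cElt_mem (s i : ℕ) : cElt k n s i ∈ invariants k n := by
  intro σ
  unfold cElt
  rw [permAut_mk, Cpoly_perm]

lemma basisElt_mem (r ε) : basisElt k n r ε ∈ invariants k n := by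
  unfold basisElt
  refine mul_mem (prod_mem fun i _ => pow_mem (cElt_mem k n _ _) _) (prod_mem fun s _ => prod_mem fun i _ => ?_)
  split_ifs
  · exact cElt_mem k n _ _
  · exact one_mem _

/-- leading exponent of `c_{s,i}` -/
def lexp (s i : ℕ) : (Fin n ⊕ Fin n) →₀ ℕ :=
  ex (fun j => if j.val < s then 1 else 0) (fun j => if s ≤ j.val ∧ j.val < s + i then 1 else 0)

lemma card_init (s : ℕ) (h : s ≤ n) : (Finset.univ.filter fun j : Fin n => j.val < s).card = s := by
  rw [← Finset.card_map Fin.valEmbedding]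
  have : Finset.map Fin.valEmbedding (Finset.univ.filter fun j : Fin n => j.val < s) = Finset.range s := by
    ext x
    simp only [Finset.mem_map, Finset.mem_filter, Finset.mem_univ, true_and, Fin.valEmbedding_apply, Finset.mem_range]
    constructor
    · rintro ⟨a, h, rfl⟩; exact h
    · intro hx; exact ⟨⟨x, by omega⟩, hx, rfl⟩
  rw [this, Finset.card_range]

lemma card_mid (s i : ℕ) (h : s + i ≤ n) :
    (Finset.univ.filter fun j : Fin n => s ≤ j.val ∧ j.val < s + i).card = i := by
  rw [← Finset.card_map Fin.valEmbedding]
  have : Finset.map Fin.valEmbedding (Finset.univ.filter fun j : Fin n => s ≤ j.val ∧ j.val < s + i) = Finset.Ico s (s + i) := by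
    ext x
    simp only [Finset.mem_map, Finset.mem_filter, Finset.mem_univ, true_and, Fin.valEmbedding_apply, Finset.mem_Ico]
    constructor
    · rintro ⟨a, h, rfl⟩; exact h
    · intro hx; exact ⟨⟨x, by omega⟩, hx, rfl⟩
  rw [this, Nat.card_Ico]; omega

lemma lexp_eq (s i : ℕ) : lexp n s i = ex (ind (Finset.univ.filter fun j : Fin n => j.val < s))
    (ind (Finset.univ.filter fun j : Fin n => s ≤ j.val ∧ j.val < s + i)) := by
  ext (j | j) <;> simp [lexp, ind]

lemma Cpoly_lead (s i : ℕ) (h : s + i ≤ n) : IsLead (mord n) (Cpoly k n s i) (lexp n s i) := by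
  classical
  rw [Cpoly_eq]
  constructor
  · rw [MvPolynomial.coeff_sum, Finset.sum_eq_single
      (Finset.univ.filter fun j : Fin n => j.val < s, Finset.univ.filter fun j : Fin n => s ≤ j.val ∧ j.val < s + i)]
    · rw [coeff_monomial, if_pos (lexp_eq n s i).symm]
    · rintro ⟨M, L⟩ _ hne
      rw [coeff_monomial, if_neg]
      intro he
      apply hne
      rw [lexp_eq] at he
      refine Prod.ext (ind_inj fun j => ?_) (ind_inj fun j => ?_)
      · exact DFunLike.congr_fun he (Sum.inl j)
      · exact DFunLike.congr_fun he (Sum.inr j)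
    · intro hn
      exfalso
      apply hn
      simp only [Finset.mem_filter, Finset.mem_univ, true_and]
      refine ⟨card_init n s (by omega), card_mid n s i h, ?_⟩
      rw [Finset.disjoint_left]
      intro j hj
      simp at hj ⊢
      omega
  · intro e he
    rw [MvPolynomial.coeff_sum] at he
    obtain ⟨⟨M, L⟩, hp, he⟩ := Finset.exists_ne_zero_of_sum_ne_zero he
    simp only [Finset.mem_filter, Finset.mem_univ, true_and] at hp
    obtain ⟨hM, hL, hd⟩ := hp
    rw [coeff_monomial] at he
    by_cases hex : ex (ind M) (ind L) = e
    swap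
    · simp [hex] at he
    rw [← hex]
    by_contra hlt
    rw [not_le, mord_lt] at hlt
    rcases hlt with ⟨p, h1, h2⟩ | ⟨p, h0, h1, h2⟩
    · simp only [lexp, ex_inl, ind] at h1 h2
      have hpM : p ∈ M := by by_contra hc; simp [hc] at h2
      have hps : ¬ p.val < s := by intro hc; simp [hc, hpM] at h2
      have hsub : insert p (Finset.univ.filter fun j : Fin n => j.val < s) ⊆ M := by
        intro j hj
        rcases Finset.mem_insert.1 hj with rfl | hj
        · exact hpM
        · simp at hj
          have := h1 j (by rw [Fin.lt_def]; omega)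
          by_contra hc
          simp [hc, hj] at this
      have hcard := Finset.card_le_card hsub
      rw [Finset.card_insert_of_notMem (by simpa using hps), card_init n s (by omega)] at hcard
      omega
    · simp only [lexp, ex_inl, ex_inr, ind] at h0 h1 h2
      have hpL : p ∈ L := by by_contra hc; simp [hc] at h2
      have hps : ¬ (s ≤ p.val ∧ p.val < s + i) := by intro hc; simp [hc, hpL] at h2
      have hpM : p ∉ M := fun hc => Finset.disjoint_left.1 hd hc hpL
      have hps' : ¬ p.val < s := by
        intro hc; have := h0 p; simp [hc, hpM] at this
      have hsub : insert p (Finset.univ.filter fun j : Fin n => s ≤ j.val ∧ j.val < s + i) ⊆ L := by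
        intro j hj
        rcases Finset.mem_insert.1 hj with rfl | hj
        · exact hpL
        · simp at hj
          have := h1 j (by rw [Fin.lt_def]; omega)
          by_contra hc
          simp [hc, hj] at this
      have hcard := Finset.card_le_card hsub
      rw [Finset.card_insert_of_notMem (by simpa using hps), card_mid n s i h] at hcard
      omega

/-- leading exponent of a basis element -/
def lq (q : (Fin n → ℕ) × (ℕ → ℕ → Bool)) : (Fin n ⊕ Fin n) →₀ ℕ :=
  ∑ i : Fin n, q.1 i • lexp n (i + 1) 0 + ∑ s ∈ Finset.range (n + 1), ∑ i ∈ Finset.range (n + 1),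
    if q.2 s i then lexp n s i else 0

lemma basisElt_lead (q : (Fin n → ℕ) × (ℕ → ℕ → Bool)) (hq : Admissible n q.2)
    (hr : red (lq n q) = lq n q) :
    IsLead (mord n) (nf k n (basisElt k n q.1 q.2)) (lq n q) := by
  have : basisElt k n q.1 q.2 = Ideal.Quotient.mk _ ((∏ i : Fin n, Cpoly k n (i + 1) 0 ^ q.1 i) *
    ∏ s ∈ Finset.range (n + 1), ∏ i ∈ Finset.range (n + 1),
      if q.2 s i then Cpoly k n s i else 1) := by
    simp only [basisElt, eElt, cElt, map_mul, map_prod, map_pow, apply_ite (Ideal.Quotient.mk (Ideal.span (relSet k n))), map_one]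
  rw [this, nf_mk]
  apply NF_lead _ _ _ _ _ hr
  refine IsLead.mul (IsLead.prod _ _ _ fun i _ => IsLead.pow (Cpoly_lead k n _ _ (by omega)) _) ?_
  refine IsLead.prod _ _ _ fun s _ => IsLead.prod _ _ _ fun i _ => ?_
  by_cases h : q.2 s i = true
  · rw [if_pos h, if_pos h]
    have := hq.1 s i h
    exact Cpoly_lead k n _ _ (by omega)
  · rw [if_neg h, if_neg h]
    exact IsLead.one _

end Aux3

section Aux4

/-- covered positions -/
def Cov (ε : ℕ → ℕ → Bool) (x : ℕ) : Prop := ∃ s i, ε s i = true ∧ s ≤ x ∧ x < s + i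

lemma Cov_lt {n : ℕ} {ε : ℕ → ℕ → Bool} (h : Admissible n ε) {x : ℕ} (hx : Cov ε x) : x < n := by
  obtain ⟨s, i, he, h1, h2⟩ := hx
  have := h.1 s i he
  omega

lemma adm_eq {n : ℕ} {ε : ℕ → ℕ → Bool} (h : Admissible n ε) {s i t j x : ℕ} (h1 : ε s i = true)
    (h2 : ε t j = true) (hs : s ≤ x) (hs' : x ≤ s + i) (ht : t ≤ x) (ht' : x ≤ t + j) : s = t ∧ i = j := by
  by_contra hne
  have hne' : (s, i) ≠ (t, j) := by simpa using hne
  rcases le_total s t with hst | hst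
  · have := h.2 s i t j h1 h2 hne' hst; omega
  · have := h.2 t j s i h2 h1 hne'.symm hst; omega

/-- maximal runs of a predicate -/
def Run (U : ℕ → Prop) (s i : ℕ) : Prop :=
  1 ≤ i ∧ (∀ x, s ≤ x → x < s + i → U x) ∧ ¬ U (s + i) ∧ (s = 0 ∨ ¬ U (s - 1))

lemma run_char1 {n : ℕ} {ε : ℕ → ℕ → Bool} (h : Admissible n ε) (s i : ℕ) (he : ε s i = true) :
    Run (Cov ε) s i := by
  have hi := h.1 s i he
  refine ⟨hi.2.1, fun x h1 h2 => ⟨s, i, he, h1, h2⟩, ?_, ?_⟩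
  · rintro ⟨t, j, hc, h1, h2⟩
    obtain ⟨rfl, rfl⟩ := adm_eq h he hc (x := s + i) (by omega) le_rfl h1 h2.le
    omega
  · by_cases hs : s = 0
    · exact Or.inl hs
    right
    rintro ⟨t, j, hc, h1, h2⟩
    obtain ⟨rfl, rfl⟩ := adm_eq h he hc (x := s) (by omega) (by omega) (by omega) (by omega)
    omega

lemma cov_start {ε : ℕ → ℕ → Bool} {s : ℕ} (h1 : Cov ε s) (h2 : s = 0 ∨ ¬ Cov ε (s - 1)) : ∃ i, ε s i = true := by
  obtain ⟨t, j, hc, h3, h4⟩ := h1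
  rcases h3.lt_or_eq with h5 | rfl
  · exfalso
    rcases h2 with h2 | h2
    · omega
    · exact h2 ⟨t, j, hc, by omega, by omega⟩
  · exact ⟨j, hc⟩

lemma run_char {n : ℕ} {ε : ℕ → ℕ → Bool} (h : Admissible n ε) (s i : ℕ) :
    ε s i = true ↔ Run (Cov ε) s i := by
  refine ⟨run_char1 h s i, ?_⟩
  rintro ⟨h1, h2, h3, h4⟩
  obtain ⟨j, hj⟩ := cov_start (h2 s le_rfl (by omega)) h4
  obtain ⟨g1, g2, g3, g4⟩ := run_char1 h s j hj
  have : i = j := by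
    rcases lt_trichotomy i j with hij | hij | hij
    · exact absurd (g2 (s + i) (by omega) (by omega)) h3
    · exact hij
    · exact absurd (h2 (s + j) (by omega) (by omega)) g3
  rw [this]; exact hj

lemma start_char {n : ℕ} {ε : ℕ → ℕ → Bool} (h : Admissible n ε) (s : ℕ) :
    (∃ i, ε s i = true) ↔ Cov ε s ∧ (s = 0 ∨ ¬ Cov ε (s - 1)) := by
  constructor
  · rintro ⟨i, hi⟩
    obtain ⟨g1, g2, g3, g4⟩ := run_char1 h s i hi
    exact ⟨g2 s le_rfl (by omega), g4⟩
  · rintro ⟨h1, h2⟩; exact cov_start h1 h2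

open Classical in
lemma exists_eps (n : ℕ) (U : ℕ → Prop) (hU : ∀ x, U x → x < n) :
    ∃ ε : ℕ → ℕ → Bool, Admissible n ε ∧ ∀ x, Cov ε x ↔ U x := by
  refine ⟨fun s i => decide (Run U s i), ⟨?_, ?_⟩, ?_⟩
  · intro s i h
    obtain ⟨h1, h2, -, -⟩ := of_decide_eq_true h
    have := hU _ (h2 (s + i - 1) (by omega) (by omega))
    omega
  · intro s i t j h h' hne hst
    obtain ⟨h1, h2, h3, h4⟩ := of_decide_eq_true h
    obtain ⟨g1, g2, g3, g4⟩ := of_decide_eq_true h'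
    rcases hst.lt_or_eq with hlt | rfl
    · by_contra hc
      rcases g4 with g4 | g4
      · omega
      · exact g4 (h2 _ (by omega) (by omega))
    · exfalso
      rcases lt_trichotomy i j with hij | hij | hij
      · exact h3 (g2 _ (by omega) (by omega))
      · exact hne (by rw [hij])
      · exact g3 (h2 _ (by omega) (by omega))
  · intro x
    constructor
    · rintro ⟨s, i, h, h5, h6⟩
      obtain ⟨h1, h2, h3, h4⟩ := of_decide_eq_true h
      exact h2 x h5 h6
    · intro hx
      have e1 : ∃ s, s ≤ x ∧ ∀ y, s ≤ y → y ≤ x → U y := ⟨x, le_rfl, fun y h1 h2 => by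
        rwa [le_antisymm h2 h1]⟩
      have e2 : ∃ t, x < t ∧ ¬ U t := ⟨n + x + 1, by omega, fun h => by have := hU _ h; omega⟩
      have s1 := Nat.find_spec e1
      have s2 := fun {m} => Nat.find_min e1 (m := m)
      have t1 := Nat.find_spec e2
      have t2 := fun {m} => Nat.find_min e2 (m := m)
      generalize Nat.find e1 = s at s1 s2
      generalize Nat.find e2 = t at t1 t2
      refine ⟨s, t - s, decide_eq_true ⟨by omega, ?_, ?_, ?_⟩, s1.1, by omega⟩
      · intro y h1 h2
        by_cases hy : y ≤ x
        · exact s1.2 y h1 hy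
        · by_contra hc
          exact t2 (m := y) (by omega) ⟨by omega, hc⟩
      · rw [show s + (t - s) = t by omega]; exact t1.2
      · by_cases hs : s = 0
        · exact Or.inl hs
        right
        intro hc
        refine s2 (m := s - 1) (by omega) ⟨by omega, fun y h1 h2 => ?_⟩
        by_cases hy : y = s - 1
        · rwa [hy]
        · exact s1.2 y (by omega) h2

open Classical in
lemma lq_inr (q : (Fin n → ℕ) × (ℕ → ℕ → Bool)) (hq : Admissible n q.2) (j : Fin n) :
    lq n q (Sum.inr j) = if Cov q.2 j then 1 else 0 := by
  have h1 : lq n q (Sum.inr j) = ∑ s ∈ Finset.range (n + 1), ∑ i ∈ Finset.range (n + 1),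
    if q.2 s i = true ∧ s ≤ j.val ∧ j.val < s + i then 1 else 0 := by
    unfold lq
    rw [Finsupp.add_apply, Finsupp.finsetSum_apply, Finsupp.finsetSum_apply, Finset.sum_eq_zero, zero_add]
    · refine Finset.sum_congr rfl fun s _ => ?_
      rw [Finsupp.finsetSum_apply]
      refine Finset.sum_congr rfl fun i _ => ?_
      by_cases h : q.2 s i = true <;> simp [h, lexp]
    · intro i _
      simp [lexp]
  rw [h1]
  split_ifs with h
  · obtain ⟨s, i, he, hs, hi⟩ := h
    have hb := hq.1 s i he
    rw [Finset.sum_eq_single s, Finset.sum_eq_single i]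
    · simp [he, hs, hi]
    · intro i' _ hne
      rw [if_neg]
      rintro ⟨a1, a2, a3⟩
      exact hne (adm_eq hq a1 he a2 a3.le hs hi.le).2
    · intro h; simp at h; omega
    · intro s' _ hne
      refine Finset.sum_eq_zero fun i' _ => ?_
      rw [if_neg]
      rintro ⟨a1, a2, a3⟩
      exact hne (adm_eq hq a1 he a2 a3.le hs hi.le).1
    · intro h; simp at h; omega
  · refine Finset.sum_eq_zero fun s _ => Finset.sum_eq_zero fun i _ => ?_
    rw [if_neg]
    rintro ⟨a1, a2, a3⟩
    exact h ⟨s, i, a1, a2, a3⟩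

open Classical in
/-- consecutive differences of the leading `w`-exponents -/
def dif (n : ℕ) (q : (Fin n → ℕ) × (ℕ → ℕ → Bool)) (x : ℕ) : ℕ :=
  if h : x < n then q.1 ⟨x, h⟩ + (if ∃ i, q.2 (x + 1) i = true then 1 else 0) else 0

open Classical in
lemma lq_inl (q : (Fin n → ℕ) × (ℕ → ℕ → Bool)) (hq : Admissible n q.2) (j : Fin n) :
    lq n q (Sum.inl j) = ∑ x ∈ Finset.Ico j.val n, dif n q x := by
  have hA : (∑ i : Fin n, q.1 i • lexp n (i + 1) 0) (Sum.inl j) =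
      ∑ i : Fin n, if j.val ≤ i.val then q.1 i else 0 := by
    rw [Finsupp.finsetSum_apply]
    refine Finset.sum_congr rfl fun i _ => ?_
    simp [lexp]
  have hB : (∑ s ∈ Finset.range (n + 1), ∑ i ∈ Finset.range (n + 1),
      if q.2 s i then lexp n s i else 0) (Sum.inl j) =
      ∑ i : Fin n, if j.val ≤ i.val then (if ∃ t, q.2 (i + 1) t = true then 1 else 0) else 0 := by
    have key : ∀ s, (∑ i ∈ Finset.range (n + 1), if q.2 s i then lexp n s i else 0) (Sum.inl j) =
        if j.val < s then (if ∃ t, q.2 s t = true then 1 else 0) else 0 := by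
      intro s
      rw [Finsupp.finsetSum_apply]
      by_cases hex : ∃ t, q.2 s t = true
      · rw [if_pos hex]
        obtain ⟨t, ht⟩ := hex
        have hb := hq.1 s t ht
        rw [Finset.sum_eq_single t]
        · simp [ht, lexp]
        · intro t' _ hne
          rw [if_neg]
          · rfl
          · intro ht'
            exact hne (adm_eq hq ht' ht (x := s) le_rfl (by omega) le_rfl (by omega)).2
        · intro h; simp at h; omega
      · rw [if_neg hex, ite_self]
        refine Finset.sum_eq_zero fun t _ => ?_
        rw [if_neg fun h => hex ⟨t, h⟩]
        rfl
    rw [Finsupp.finsetSum_apply, Finset.sum_congr rfl fun s _ => key s, Finset.sum_range_succ',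
      Finset.sum_range]
    simp
  have hC : ∑ x ∈ Finset.Ico j.val n, dif n q x = ∑ i : Fin n, if j.val ≤ i.val then dif n q i else 0 := by
    rw [← Finset.sum_range (f := fun x => if j.val ≤ x then dif n q x else 0), ← Finset.sum_filter]
    refine Finset.sum_congr ?_ fun _ _ => rfl
    ext x; simp; omega
  unfold lq
  rw [Finsupp.add_apply, hA, hB, hC, ← Finset.sum_add_distrib]
  refine Finset.sum_congr rfl fun i _ => ?_
  by_cases h : j.val ≤ i.val <;> simp [h, dif]

lemma lq_red (q : (Fin n → ℕ) × (ℕ → ℕ → Bool)) (hq : Admissible n q.2) : red (lq n q) = lq n q := by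
  classical
  ext (j | j)
  · rfl
  · rw [red_inr, lq_inr n q hq]
    split_ifs <;> rfl

lemma lq_inj (q q' : (Fin n → ℕ) × (ℕ → ℕ → Bool)) (hq : Admissible n q.2) (hq' : Admissible n q'.2)
    (h : lq n q = lq n q') : q = q' := by
  classical
  have hcov : Cov q.2 = Cov q'.2 := by
    funext x
    by_cases hx : x < n
    · have := DFunLike.congr_fun h (Sum.inr ⟨x, hx⟩)
      rw [lq_inr n q hq, lq_inr n q' hq'] at this
      by_cases h1 : Cov q.2 x <;> by_cases h2 : Cov q'.2 x <;> simp_all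
    · apply propext
      exact ⟨fun h => absurd (Cov_lt hq h) hx, fun h => absurd (Cov_lt hq' h) hx⟩
  have he : q.2 = q'.2 := by
    funext s i
    rw [Bool.eq_iff_iff, run_char hq, run_char hq', hcov]
  have hsum : ∀ x, ∑ y ∈ Finset.Ico x n, dif n q y = ∑ y ∈ Finset.Ico x n, dif n q' y := by
    intro x
    by_cases hx : x < n
    · have := DFunLike.congr_fun h (Sum.inl ⟨x, hx⟩)
      rwa [lq_inl n q hq, lq_inl n q' hq'] at this
    · rw [Finset.Ico_eq_empty_of_le (by omega)]; rfl
  refine Prod.ext (funext fun i => ?_) he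
  have h1 := hsum i
  have h2 := hsum (i + 1)
  rw [Finset.sum_eq_sum_Ico_succ_bot i.isLt, Finset.sum_eq_sum_Ico_succ_bot i.isLt, h2] at h1
  have h3 := Nat.add_right_cancel h1
  simp only [dif, i.isLt, dite_true, he] at h3
  simpa using h3

lemma lq_surj (E : (Fin n ⊕ Fin n) →₀ ℕ) (h1 : ∀ i, E (Sum.inr i) ≤ 1)
    (h2 : ∀ i j : Fin n, i.val + 1 = j.val → (E (Sum.inl j) < E (Sum.inl i) ∨
      (E (Sum.inl j) = E (Sum.inl i) ∧ E (Sum.inr j) ≤ E (Sum.inr i)))) :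
    ∃ q : (Fin n → ℕ) × (ℕ → ℕ → Bool), Admissible n q.2 ∧ lq n q = E := by
  classical
  obtain ⟨ε, hε, hcov⟩ := exists_eps n (fun x => ∃ h : x < n, E (Sum.inr ⟨x, h⟩) = 1) (fun x h => h.1)
  let A : ℕ → ℕ := fun x => if h : x < n then E (Sum.inl ⟨x, h⟩) else 0
  have hA : ∀ x, A (x + 1) ≤ A x := by
    intro x
    by_cases hx : x + 1 < n
    · have := h2 ⟨x, by omega⟩ ⟨x + 1, hx⟩ rfl
      simp only [A, hx, dif_pos, show x < n by omega]
      omega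
    · simp [A, hx]
  have hst : ∀ x, x < n → (∃ i, ε (x + 1) i = true) → A (x + 1) < A x := by
    intro x hx h
    rw [start_char hε] at h
    obtain ⟨g1, g2⟩ := h
    have hx1 := Cov_lt hε g1
    have := h2 ⟨x, by omega⟩ ⟨x + 1, hx1⟩ rfl
    simp only [A, hx1, dif_pos, show x < n by omega]
    rcases this with h | ⟨_, h⟩
    · exact h
    · exfalso
      rw [hcov] at g1
      obtain ⟨_, g1⟩ := g1
      rcases g2 with g2 | g2
      · omega
      · apply g2
        rw [hcov]
        refine ⟨by omega, ?_⟩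
        have a1 := h1 ⟨x, by omega⟩
        simp only [Nat.add_sub_cancel]
        omega
  let q : (Fin n → ℕ) × (ℕ → ℕ → Bool) :=
    (fun i => A i - A (i + 1) - (if ∃ t, ε (i + 1) t = true then 1 else 0), ε)
  have hd : ∀ x, x < n → dif n q x = A x - A (x + 1) := by
    intro x hx
    have g1 := hst x hx
    simp only [dif, hx, dif_pos, q]
    split_ifs with h
    · have := g1 h; omega
    · omega
  have hsum : ∀ m x, x + m = n → ∑ y ∈ Finset.Ico x n, dif n q y = A x := by
    intro m
    induction m with
    | zero => intro x hx; simp only [A]; rw [Finset.Ico_eq_empty_of_le (by omega), dif_neg (by omega)]; rfl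
    | succ m ih =>
      intro x hx
      rw [Finset.sum_eq_sum_Ico_succ_bot (by omega), ih (x + 1) (by omega), hd x (by omega)]
      have := hA x
      omega
  refine ⟨q, hε, ?_⟩
  ext (j | j)
  · rw [lq_inl n q hε, hsum (n - j) j (by omega)]
    simp [A]
  · rw [lq_inr n q hε]
    have a1 := h1 j
    have : Cov q.2 j ↔ E (Sum.inr j) = 1 := by
      rw [hcov]; simp
    by_cases hj : E (Sum.inr j) = 1
    · rw [if_pos (this.2 hj), hj]
    · rw [if_neg (fun h => hj (this.1 h))]; omega

end Aux4

/-- the elements `(∏ e_i^{r_i})·(∏ c_{s,i}^{ε_{s,i}})`, for `r_i` ranging over all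
nonnegative integers and `ε` ranging over all admissible exponent patterns, form a basis of
`R^{Σ_n}` as a `k`-module. -/
theorem exists_basis_invariants (hn : 0 < n) :
    ∃ b : Module.Basis {q : (Fin n → ℕ) × (ℕ → ℕ → Bool) // Admissible n q.2} k (invariants k n),
      ∀ q, (b q : RR k n) = basisElt k n q.1.1 q.1.2 := by
  let v : {q : (Fin n → ℕ) × (ℕ → ℕ → Bool) // Admissible n q.2} → invariants k n :=
    fun q => ⟨basisElt k n q.1.1 q.1.2, basisElt_mem k n _ _⟩
  obtain ⟨hli, hsp⟩ := abs_basis (mord n) ((nf k n).comp (invariants k n).val.toLinearMap)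
    (fun x y h => Subtype.ext (nf_inj k n h)) v (fun q => lq n q.1)
    (fun q q' h => Subtype.ext (lq_inj n q.1 q'.1 q.2 q'.2 h))
    (fun q => basisElt_lead k n q.1 q.2 (lq_red n q.1 q.2))
    (by
      intro x hx
      obtain ⟨h1, h2⟩ := lead_canonical k n x.1 x.2 (fun h => hx (Subtype.ext h)) _ rfl
      obtain ⟨q, hq, he⟩ := lq_surj n _ h1 h2
      exact ⟨⟨q, hq⟩, he.symm⟩)
  refine ⟨Module.Basis.mk hli hsp, fun q => ?_⟩
  rw [Module.Basis.mk_apply]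

end
end

section
/- In the multivariable polynomial ring A[X_1,…,X_n] over a commutative ring A, for every 0 ≤ i ≤ n the i-th elementary symmetric polynomial of the squares satisfies the identity σ_i(X_1²,…,X_n²) = Σ_{a+b=2i, 0≤a,b≤n} (−1)^{a+i} σ_a(X_1,…,X_n)·σ_b(X_1,…,X_n), where σ_0 = 1. -/
open MvPolynomial

theorem coeff_prod_aux {R : Type*} [CommRing R] {n : ℕ} (f : Fin n → R) (d k : ℕ) (hd : 0 < d) :
    (∏ j, (1 + Polynomial.C (f j) * Polynomial.X ^ d)).coeff (d * k)
      = ∑ t ∈ Finset.univ.powersetCard k, ∏ j ∈ t, f j := by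
  rw [Finset.prod_one_add, Polynomial.finset_sum_coeff, Finset.powersetCard_eq_filter,
    Finset.sum_filter]
  refine Finset.sum_congr rfl fun t _ => ?_
  rw [Finset.prod_mul_distrib, ← map_prod, Finset.prod_const, ← pow_mul, Polynomial.coeff_C_mul,
    Polynomial.coeff_X_pow]
  have : d * k = d * t.card ↔ t.card = k := by
    rw [Nat.mul_right_inj hd.ne']; exact eq_comm
  simp [this]

/-- in `A[X_1,…,X_n]`, for every `0 ≤ i ≤ n`,
`σ_i(X_1²,…,X_n²) = Σ_{a+b=2i, 0≤a,b≤n} (−1)^{a+i} σ_a·σ_b`. -/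
theorem esymm_squares_eq (A : Type*) [CommRing A] (n : ℕ) (i : ℕ) (hi : i ≤ n) :
    (∑ t ∈ Finset.univ.powersetCard i, ∏ j ∈ t, (X j : MvPolynomial (Fin n) A) ^ 2)
      = ∑ p ∈ (Finset.HasAntidiagonal.antidiagonal (2 * i)).filter (fun p => p.1 ≤ n ∧ p.2 ≤ n),
          (-1 : MvPolynomial (Fin n) A) ^ (p.1 + i) * esymm (Fin n) A p.1 * esymm (Fin n) A p.2 := by
  have hz : ∀ k, n < k → esymm (Fin n) A k = 0 := by
    intro k hk
    rw [esymm, Finset.powersetCard_eq_empty.2 (by simpa using hk), Finset.sum_empty]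
  rw [Finset.sum_filter_of_ne (by
    intro p _ hp
    by_contra hc
    apply hp
    rcases not_and_or.1 hc with h | h
    · rw [hz p.1 (not_le.1 h)]; ring
    · rw [hz p.2 (not_le.1 h)]; ring)]
  have hneg : ∀ (g : Fin n → MvPolynomial (Fin n) A) (k : ℕ),
      (∑ t ∈ Finset.univ.powersetCard k, ∏ j ∈ t, -g j)
        = (-1) ^ k * ∑ t ∈ Finset.univ.powersetCard k, ∏ j ∈ t, g j := by
    intro g k
    rw [Finset.mul_sum]
    refine Finset.sum_congr rfl fun t ht => ?_
    rw [Finset.prod_neg, (Finset.mem_powersetCard.1 ht).2]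
  have key := coeff_prod_aux (fun j => -((X j : MvPolynomial (Fin n) A) ^ 2)) 2 i two_pos
  have hprod : (∏ j, (1 + Polynomial.C (-((X j : MvPolynomial (Fin n) A) ^ 2)) * Polynomial.X ^ 2))
      = (∏ j, (1 + Polynomial.C (-(X j : MvPolynomial (Fin n) A)) * Polynomial.X ^ 1))
        * ∏ j, (1 + Polynomial.C (X j : MvPolynomial (Fin n) A) * Polynomial.X ^ 1) := by
    rw [← Finset.prod_mul_distrib]
    refine Finset.prod_congr rfl fun j _ => ?_
    simp only [map_neg, map_pow]
    ring
  have h1 : ∀ (g : Fin n → MvPolynomial (Fin n) A) (k : ℕ),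
      (∏ j, (1 + Polynomial.C (g j) * Polynomial.X ^ 1)).coeff k
        = ∑ t ∈ Finset.univ.powersetCard k, ∏ j ∈ t, g j := by
    intro g k
    simpa only [one_mul] using coeff_prod_aux g 1 k one_pos
  rw [hneg, hprod, Polynomial.coeff_mul] at key
  have hs : ((-1 : MvPolynomial (Fin n) A) ^ i) * (-1) ^ i = 1 := by
    rw [← mul_pow]; simp
  calc _ = (-1) ^ i * ((-1) ^ i * ∑ t ∈ Finset.univ.powersetCard i,
        ∏ j ∈ t, (X j : MvPolynomial (Fin n) A) ^ 2) := by rw [← mul_assoc, hs, one_mul]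
    _ = _ := by
      rw [← key, Finset.mul_sum]
      refine Finset.sum_congr rfl fun p _ => ?_
      rw [h1, h1, hneg, esymm, esymm, pow_add]
      ring
end
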